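/- Under Assumptions A1–A2, the system y_{t+1} = θ·f(y_t) + u_t + w_{t+1} is globally stabilizable if: (i) there exist constants k₁, k₂ > 0 such that |f(x)| ≤ k₁·e^{k₂|x|} for all x ∈ ℝ; (ii) there exist numbers b < 4 and L > 0 such that liminf_{l→+∞} ℓ(S_b^L ∩ [−l, l])/l > 0; and (iii) the set S_b^L contains a nonempty open interval (a consequence of the paper's assumption that f is piecewise continuous). -/

import Mathlib

open MeasureTheory ProbabilityTheory Filter

namespace Stab

lemma gauss_rot (c s : ℝ) (h : c ^ 2 + s ^ 2 = 1) :
    ((gaussianReal 0 1).prod (gaussianReal 0 1)).map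
      (fun x : ℝ × ℝ => (c * x.1 + s * x.2, -s * x.1 + c * x.2))
      = (gaussianReal 0 1).prod (gaussianReal 0 1) := by
  set z : ℂ := ⟨c, s⟩ with hz
  have hn : ‖z‖ = 1 := by
    rw [Complex.norm_def, Complex.normSq_apply, hz]
    simp only
    rw [show c * c + s * s = 1 by nlinarith, Real.sqrt_one]
  have hz0 : z ≠ 0 := by
    intro h0; rw [h0] at hn; simp at hn
  have hc : Real.cos z.arg = c := by rw [Complex.cos_arg hz0, hn]; simp [hz]
  have hs : Real.sin z.arg = s := by rw [Complex.sin_arg, hn]; simp [hz]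
  have := IsGaussian.map_rotation_eq_self (μ := gaussianReal 0 1) (by simp) z.arg
  rw [← hc, ← hs]
  exact this

lemma innov_step {Ω E : Type*} [MeasurableSpace Ω] [MeasurableSpace E] (P : Measure Ω)
    [IsProbabilityMeasure P] (H : Ω → E) (hH : Measurable H) (η W : Ω → ℝ)
    (hηm : Measurable η) (hWm : Measurable W) (c s : E → ℝ) (hc : Measurable c)
    (hs : Measurable s) (hcs : ∀ x, c x ^ 2 + s x ^ 2 = 1)
    (hη : P.map η = gaussianReal 0 1) (hW : P.map W = gaussianReal 0 1)
    (hi : IndepFun H η P) (hi2 : IndepFun (fun ω => (H ω, η ω)) W P) :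
    P.map (fun ω => c (H ω) * W ω + s (H ω) * η ω) = gaussianReal 0 1 ∧
    P.map (fun ω => -s (H ω) * W ω + c (H ω) * η ω) = gaussianReal 0 1 ∧
    IndepFun H (fun ω => c (H ω) * W ω + s (H ω) * η ω) P ∧
    IndepFun (fun ω => (H ω, c (H ω) * W ω + s (H ω) * η ω))
      (fun ω => -s (H ω) * W ω + c (H ω) * η ω) P := by
  have e1 := (indepFun_iff_map_prod_eq_prod_map_map hH.aemeasurable hηm.aemeasurable).1 hi
  have e2 := (indepFun_iff_map_prod_eq_prod_map_map
    (hH.prodMk hηm).aemeasurable hWm.aemeasurable).1 hi2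
  have : IsProbabilityMeasure (P.map H) := Measure.isProbabilityMeasure_map hH.aemeasurable
  rw [e1, hη, hW] at e2
  set μ := P.map H with hμ
  set γ := gaussianReal 0 1 with hγ
  have mp1 : MeasurePreserving (fun ω => ((H ω, η ω), W ω)) P ((μ.prod γ).prod γ) :=
    ⟨by fun_prop, e2⟩
  have mp2 := (measurePreserving_prodAssoc μ γ γ).comp mp1
  have mp3 := ((MeasurePreserving.id μ).prod
    (Measure.measurePreserving_swap (μ := γ) (ν := γ))).comp mp2
  have mp4 := (MeasurePreserving.skew_product (μa := μ) (μc := γ.prod γ) (μd := γ.prod γ)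
    (MeasurePreserving.id μ)
    (g := fun h x => (c h * x.1 + s h * x.2, -s h * x.1 + c h * x.2))
    (by unfold Function.uncurry; fun_prop)
    (ae_of_all _ fun h => gauss_rot (c h) (s h) (hcs h))).comp mp3
  have mp5 := (MeasurePreserving.symm (MeasurableEquiv.prodAssoc)
    (measurePreserving_prodAssoc μ γ γ)).comp mp4
  have k1 : MeasurePreserving (fun ω => c (H ω) * W ω + s (H ω) * η ω) P γ :=
    (measurePreserving_fst.comp (measurePreserving_snd.comp mp4))
  have k2 : MeasurePreserving (fun ω => -s (H ω) * W ω + c (H ω) * η ω) P γ :=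
    (measurePreserving_snd.comp mp5)
  have k3 : MeasurePreserving (fun ω => (H ω, c (H ω) * W ω + s (H ω) * η ω)) P (μ.prod γ) :=
    measurePreserving_fst.comp mp5
  refine ⟨k1.map_eq, k2.map_eq, ?_, ?_⟩
  · rw [indepFun_iff_map_prod_eq_prod_map_map hH.aemeasurable k1.measurable.aemeasurable,
      k1.map_eq]
    exact k3.map_eq
  · rw [indepFun_iff_map_prod_eq_prod_map_map k3.measurable.aemeasurable
      k2.measurable.aemeasurable, k3.map_eq, k2.map_eq]
    exact mp5.map_eq

lemma gauss_scale_lower (A : Set ℝ) (hA : MeasurableSet A) (σ R : ℝ) (hσ : 0 < σ) (hR : 0 ≤ R) :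
    ENNReal.ofReal ((Real.sqrt (2 * Real.pi) * σ)⁻¹ * Real.exp (-(R ^ 2 / 2))) *
      volume (A ∩ Set.Icc (-(R * σ)) (R * σ)) ≤ gaussianReal 0 1 {x | σ * x ∈ A} := by
  have h1 : gaussianReal 0 1 {x | σ * x ∈ A} = (gaussianReal 0 1).map (σ * ·) A := by
    rw [Measure.map_apply (by fun_prop) hA]; rfl
  rw [h1, gaussianReal_map_const_mul, gaussianReal_apply]
  swap
  · rw [mul_one]; intro h
    have := congrArg NNReal.toReal h
    simp at this; exact hσ.ne' this
  calc _ = ∫⁻ x in A ∩ Set.Icc (-(R * σ)) (R * σ),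
        ENNReal.ofReal ((Real.sqrt (2 * Real.pi) * σ)⁻¹ * Real.exp (-(R ^ 2 / 2))) := by
        rw [setLIntegral_const]
    _ ≤ ∫⁻ x in A ∩ Set.Icc (-(R * σ)) (R * σ), gaussianPDF (σ * 0) (.mk (σ ^ 2) (sq_nonneg _) * 1) x := by
        apply setLIntegral_mono (measurable_gaussianPDF _ _)
        intro x hx
        rw [gaussianPDF]
        apply ENNReal.ofReal_le_ofReal
        rw [gaussianPDFReal]
        have hsq : x ^ 2 ≤ (R * σ) ^ 2 := sq_le_sq' hx.2.1 hx.2.2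
        have e : Real.sqrt (2 * Real.pi * ((NNReal.mk (σ ^ 2) (sq_nonneg _) * 1 : NNReal) : ℝ))
            = Real.sqrt (2 * Real.pi) * σ := by
          rw [mul_one, NNReal.coe_mk, Real.sqrt_mul (by positivity), Real.sqrt_sq hσ.le]
        rw [e]
        gcongr
        simp only [mul_zero, sub_zero, mul_one, NNReal.coe_mk]
        rw [neg_div, neg_le_neg_iff, div_le_div_iff₀ (by positivity) (by positivity)]
        nlinarith
    _ ≤ _ := lintegral_mono_set Set.inter_subset_left

lemma landing (f : ℝ → ℝ) (hf : Measurable f) (k₁ k₂ : ℝ) (hk₁ : 0 < k₁) (hk₂ : 0 < k₂)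
    (hfgrow : ∀ x : ℝ, |f x| ≤ k₁ * Real.exp (k₂ * |x|))
    (b L : ℝ) (hb : b < 4) (hL : 0 < L)
    (hliminf : 0 < Filter.liminf (fun l : ℝ =>
      (volume ({x : ℝ | |f x| < L * |x| ^ b} ∩ Set.Icc (-l) l)).toReal / l)
      Filter.atTop) :
    ∃ c M β : ℝ, 0 < c ∧ 0 < M ∧ 0 < β ∧ β < 4 ∧ ∀ r : ℝ, 1 ≤ r →
      ENNReal.ofReal c ≤ gaussianReal 0 1 {x | f (Real.sqrt r * x) ^ 2 ≤ M * r ^ β} := by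
  have hbd : IsBoundedUnder (· ≥ ·) atTop (fun l : ℝ =>
      (volume ({x : ℝ | |f x| < L * |x| ^ b} ∩ Set.Icc (-l) l)).toReal / l) := by
    refine ⟨0, ?_⟩
    rw [eventually_map]
    filter_upwards [eventually_ge_atTop 0] with l hl
    positivity
  obtain ⟨d, hd0, hd⟩ := exists_between hliminf
  have hev := eventually_lt_of_lt_liminf hd hbd
  obtain ⟨R, hR⟩ := eventually_atTop.1 hev
  set R0 := max R 1 with hR0
  have hR01 : 1 ≤ R0 := le_max_right _ _
  set L' := max L (k₁ * Real.exp (k₂ * R0)) with hL'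
  have hL'0 : 0 < L' := lt_max_of_lt_left hL
  set β := max b 1 with hβ
  have hβ1 : 1 ≤ β := le_max_right _ _
  have hq : 0 < (Real.sqrt (2 * Real.pi))⁻¹ * Real.exp (-(1 ^ 2 / 2)) := by positivity
  set κ := (Real.sqrt (2 * Real.pi))⁻¹ * Real.exp (-(1 ^ 2 / 2)) with hκ
  refine ⟨κ * min d 2, L' ^ 2, β, by positivity, by positivity, by linarith,
    max_lt hb (by norm_num), ?_⟩
  intro r hr
  set σ := Real.sqrt r with hσ
  have hσ1 : 1 ≤ σ := Real.one_le_sqrt.2 hr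
  have hσ0 : 0 < σ := by linarith
  have hrβ : r ^ β = (σ ^ β) ^ 2 := by
    rw [← Real.sq_sqrt (by linarith : 0 ≤ r), ← hσ, ← Real.rpow_natCast, ← Real.rpow_natCast,
      ← Real.rpow_mul hσ0.le, ← Real.rpow_mul hσ0.le, mul_comm]
  have hσβ : 1 ≤ σ ^ β := Real.one_le_rpow hσ1 (by linarith)
  set A := {y : ℝ | f y ^ 2 ≤ L' ^ 2 * r ^ β} with hA
  have hAm : MeasurableSet A := measurableSet_le (by fun_prop) (by fun_prop)
  have hmem : ∀ y, |f y| ≤ L' * σ ^ β → y ∈ A := by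
    intro y hy
    rw [hA, Set.mem_ofPred_eq, hrβ, ← mul_pow, ← sq_abs (f y)]
    gcongr
  have hsmall : ∀ y, |y| ≤ R0 → y ∈ A := by
    intro y hy
    apply hmem
    calc |f y| ≤ k₁ * Real.exp (k₂ * |y|) := hfgrow y
      _ ≤ k₁ * Real.exp (k₂ * R0) := by gcongr
      _ ≤ L' := le_max_right _ _
      _ ≤ L' * σ ^ β := by nlinarith
  have key : ENNReal.ofReal (min d 2 * σ) ≤ volume (A ∩ Set.Icc (-(1 * σ)) (1 * σ)) := by
    rw [one_mul]
    rcases le_total σ R0 with h | h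
    · have : A ∩ Set.Icc (-σ) σ = Set.Icc (-σ) σ := by
        apply Set.inter_eq_right.2
        intro y hy
        exact hsmall y ((abs_le.2 hy).trans h)
      rw [this, Real.volume_Icc]
      apply ENNReal.ofReal_le_ofReal
      nlinarith [min_le_right d 2]
    · have h2 := hR σ ((le_max_left _ _).trans h)
      rw [lt_div_iff₀ hσ0] at h2
      have hfin : volume ({x : ℝ | |f x| < L * |x| ^ b} ∩ Set.Icc (-σ) σ) ≠ ⊤ := by
        apply ne_top_of_le_ne_top _ (measure_mono Set.inter_subset_right)
        simp
      calc ENNReal.ofReal (min d 2 * σ) ≤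
          ENNReal.ofReal ((volume ({x : ℝ | |f x| < L * |x| ^ b} ∩ Set.Icc (-σ) σ)).toReal) := by
            apply ENNReal.ofReal_le_ofReal
            nlinarith [min_le_left d 2]
        _ = volume ({x : ℝ | |f x| < L * |x| ^ b} ∩ Set.Icc (-σ) σ) := ENNReal.ofReal_toReal hfin
        _ ≤ _ := by
            apply measure_mono
            rintro y ⟨hy1, hy2⟩
            refine ⟨?_, hy2⟩
            rcases le_total |y| 1 with h3 | h3
            · exact hsmall y (h3.trans hR01)
            · apply hmem
              have h4 : |y| ≤ σ := abs_le.2 hy2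
              calc |f y| ≤ L * |y| ^ b := le_of_lt hy1
                _ ≤ L * |y| ^ β := by
                  gcongr
                  exact le_max_left _ _
                _ ≤ L' * σ ^ β := by
                  gcongr
                  exact le_max_left _ _
  calc ENNReal.ofReal (κ * min d 2)
      = ENNReal.ofReal ((Real.sqrt (2 * Real.pi) * σ)⁻¹ * Real.exp (-(1 ^ 2 / 2))) *
        ENNReal.ofReal (min d 2 * σ) := by
        rw [← ENNReal.ofReal_mul (by positivity)]
        congr 1
        rw [hκ]; field_simp
    _ ≤ _ := by gcongr
    _ ≤ gaussianReal 0 1 {x | σ * x ∈ A} := gauss_scale_lower A hAm σ 1 hσ0 (by norm_num)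

/-- exit probability bounded by expected decrease of `1 / q` -/
lemma star (f : ℝ → ℝ) (hf : Measurable f) (k₁ k₂ : ℝ) (hk₁ : 0 < k₁) (hk₂ : 0 < k₂)
    (hfgrow : ∀ x : ℝ, |f x| ≤ k₁ * Real.exp (k₂ * |x|)) (q₀ : ℝ) (hq₀ : 0 < q₀) :
    ∃ K : ℝ, 0 < K ∧ ∀ r q : ℝ, 1 ≤ r → r ≤ 2 → q₀ ≤ q →
      gaussianReal 0 1 {x | q < f (Real.sqrt r * x) ^ 2} ≤
        ENNReal.ofReal K *
          ∫⁻ x, ENNReal.ofReal (1 / q - 1 / (q + f (Real.sqrt r * x) ^ 2)) ∂(gaussianReal 0 1) := by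
  by_cases h0 : volume {x | f x ≠ 0} = 0
  · refine ⟨1, one_pos, ?_⟩
    intro r q hr1 hr2 hq
    have hr : 0 < Real.sqrt r := Real.sqrt_pos.2 (by linarith)
    have : gaussianReal 0 1 {x | q < f (Real.sqrt r * x) ^ 2} = 0 := by
      apply gaussianReal_absolutelyContinuous 0 one_ne_zero
      apply measure_mono_null (t := (fun x => Real.sqrt r * x) ⁻¹' {x | f x ≠ 0})
      · intro x hx h
        simp only [Set.mem_ofPred_eq] at hx
        rw [h] at hx
        norm_num at hx; linarith
      · rw [Real.volume_preimage_mul_left hr.ne', h0, mul_zero]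
    rw [this]; exact zero_le
  · -- positive-measure case
    have hex : ∃ n : ℕ, 0 < volume ({x | 1 / ((n : ℝ) + 1) ≤ f x ^ 2} ∩ Set.Icc (-(n : ℝ)) n) := by
      by_contra hcon
      push Not at hcon
      apply h0
      have hsub : {x | f x ≠ 0} ⊆ ⋃ n : ℕ, ({x | 1 / ((n : ℝ) + 1) ≤ f x ^ 2} ∩ Set.Icc (-(n : ℝ)) n) := by
        intro x hx
        have hx2 : 0 < f x ^ 2 := by
          have : f x ≠ 0 := hx
          positivity
        obtain ⟨n1, hn1⟩ := exists_nat_one_div_lt hx2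
        obtain ⟨n2, hn2⟩ := exists_nat_ge |x|
        refine Set.mem_iUnion.2 ⟨max n1 n2, ?_, ?_⟩
        · refine le_trans ?_ hn1.le
          gcongr
          exact le_max_left _ _
        · apply abs_le.1
          refine hn2.trans ?_
          exact_mod_cast le_max_right _ _
      refine measure_mono_null hsub (measure_iUnion_null fun n => ?_)
      exact le_antisymm (hcon n) zero_le
    obtain ⟨n, hn⟩ := hex
    set A := {x | 1 / ((n : ℝ) + 1) ≤ f x ^ 2} with hA
    have hAm : MeasurableSet A := measurableSet_le (by fun_prop) (by fun_prop)
    set δ : ℝ := 1 / ((n : ℝ) + 1) with hδ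
    have hδ0 : 0 < δ := by positivity
    have hfin : volume (A ∩ Set.Icc (-(n : ℝ)) n) ≠ ⊤ := by
      apply ne_top_of_le_ne_top _ (measure_mono Set.inter_subset_right)
      simp
    set a := (volume (A ∩ Set.Icc (-(n : ℝ)) n)).toReal with ha
    have ha0 : 0 < a := ENNReal.toReal_pos hn.ne' hfin
    set κ := (Real.sqrt (2 * Real.pi) * 2)⁻¹ * Real.exp (-((n : ℝ) ^ 2 / 2)) * a with hκ
    have hκ0 : 0 < κ := by positivity
    set I := (∫⁻ x, ENNReal.ofReal (Real.exp (8 * k₂ * x) + Real.exp (-(8 * k₂) * x))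
      ∂(gaussianReal 0 1)) with hI
    have hIfin : I ≠ ⊤ := by
      have h := ((integrable_exp_mul_gaussianReal (μ := 0) (v := 1) (8 * k₂)).add
        (integrable_exp_mul_gaussianReal (μ := 0) (v := 1) (-(8 * k₂)))).lintegral_lt_top
      exact h.ne
    set J := k₁ ^ 4 * I.toReal with hJ
    have hJ0 : 0 ≤ J := by positivity
    set K := (J + 1) * (1 + δ / q₀) / (δ * κ) with hK
    refine ⟨K, by positivity, ?_⟩
    intro r q hr1 hr2 hq
    have hq0 : 0 < q := by linarith
    set σ := Real.sqrt r with hσ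
    have hσ1 : 1 ≤ σ := Real.one_le_sqrt.2 hr1
    have hσ0 : 0 < σ := by linarith
    have hσ2 : σ ≤ 2 := by
      rw [hσ, Real.sqrt_le_left (by norm_num)]; linarith
    -- upper bound
    have up : gaussianReal 0 1 {x | q < f (σ * x) ^ 2} ≤ ENNReal.ofReal (J / q ^ 2) := by
      have hmark := mul_meas_ge_le_lintegral₀ (μ := gaussianReal 0 1)
        (f := fun x => ENNReal.ofReal (Real.exp (8 * k₂ * x) + Real.exp (-(8 * k₂) * x)))
        (by fun_prop) (ENNReal.ofReal (q ^ 2 / k₁ ^ 4))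
      have hsub : {x | q < f (σ * x) ^ 2} ⊆ {x | ENNReal.ofReal (q ^ 2 / k₁ ^ 4) ≤
          ENNReal.ofReal (Real.exp (8 * k₂ * x) + Real.exp (-(8 * k₂) * x))} := by
        intro x hx
        simp only [Set.mem_ofPred_eq] at hx ⊢
        apply ENNReal.ofReal_le_ofReal
        rw [div_le_iff₀ (by positivity)]
        have h1 : |f (σ * x)| ≤ k₁ * Real.exp (2 * k₂ * |x|) := by
          refine (hfgrow _).trans ?_
          rw [abs_mul, abs_of_pos hσ0]
          gcongr k₁ * Real.exp ?_
          have := abs_nonneg x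
          have h2 : σ * |x| ≤ 2 * |x| := by gcongr
          nlinarith
        have h2 : f (σ * x) ^ 2 ≤ (k₁ * Real.exp (2 * k₂ * |x|)) ^ 2 := by
          rw [← sq_abs]; gcongr
        have h3 : q ^ 2 ≤ ((k₁ * Real.exp (2 * k₂ * |x|)) ^ 2) ^ 2 := by
          gcongr; exact hx.le.trans h2
        have h4 : ((k₁ * Real.exp (2 * k₂ * |x|)) ^ 2) ^ 2 = Real.exp (8 * k₂ * |x|) * k₁ ^ 4 := by
          rw [← pow_mul, mul_pow, ← Real.exp_nat_mul, mul_comm]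
          norm_num; left; ring
        rw [h4] at h3
        refine h3.trans ?_
        gcongr
        rcases abs_cases x with ⟨h, _⟩ | ⟨h, _⟩ <;> rw [h]
        · linarith [Real.exp_pos (-(8 * k₂) * x)]
        · rw [show 8 * k₂ * -x = -(8 * k₂) * x by ring]
          linarith [Real.exp_pos (8 * k₂ * x)]
      have h5 := (mul_le_mul_right (measure_mono hsub)
        (ENNReal.ofReal (q ^ 2 / k₁ ^ 4))).trans hmark
      have hm : gaussianReal 0 1 {x | q < f (σ * x) ^ 2} ≤ I / ENNReal.ofReal (q ^ 2 / k₁ ^ 4) := by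
        rw [ENNReal.le_div_iff_mul_le (Or.inl (by simp; positivity)) (Or.inl (by simp)), mul_comm]
        exact h5
      refine hm.trans (le_of_eq ?_)
      rw [← ENNReal.ofReal_toReal hIfin, ← ENNReal.ofReal_div_of_pos (by positivity)]
      congr 1
      rw [hJ]; field_simp
    -- lower bound
    have lo : ENNReal.ofReal (κ * (1 / q - 1 / (q + δ))) ≤
        ∫⁻ x, ENNReal.ofReal (1 / q - 1 / (q + f (σ * x) ^ 2)) ∂(gaussianReal 0 1) := by
      have hB : ENNReal.ofReal κ ≤ gaussianReal 0 1 {x | σ * x ∈ A} := by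
        refine le_trans ?_ (gauss_scale_lower A hAm σ n hσ0 (by positivity))
        rw [hκ, ENNReal.ofReal_mul (by positivity), ha, ENNReal.ofReal_toReal hfin]
        gcongr
        · have : (n : ℝ) ≤ n * σ := by
            have : (0 : ℝ) ≤ n := by positivity
            nlinarith
          linarith
        · have : (0 : ℝ) ≤ n := by positivity
          nlinarith
      calc ENNReal.ofReal (κ * (1 / q - 1 / (q + δ)))
          = ENNReal.ofReal (1 / q - 1 / (q + δ)) * ENNReal.ofReal κ := by
            rw [mul_comm, ENNReal.ofReal_mul]
            rw [sub_nonneg]; gcongr; linarith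
        _ ≤ ENNReal.ofReal (1 / q - 1 / (q + δ)) * gaussianReal 0 1 {x | σ * x ∈ A} := by gcongr
        _ = ∫⁻ x in {x | σ * x ∈ A}, ENNReal.ofReal (1 / q - 1 / (q + δ)) ∂(gaussianReal 0 1) := by
            rw [setLIntegral_const]
        _ ≤ ∫⁻ x in {x | σ * x ∈ A}, ENNReal.ofReal (1 / q - 1 / (q + f (σ * x) ^ 2))
              ∂(gaussianReal 0 1) := by
            apply setLIntegral_mono (by fun_prop)
            intro x hx
            have hx' : δ ≤ f (σ * x) ^ 2 := hx
            apply ENNReal.ofReal_le_ofReal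
            gcongr
        _ ≤ _ := setLIntegral_le_lintegral _ _
    refine up.trans (le_trans ?_ (mul_le_mul_right lo (ENNReal.ofReal K)))
    rw [← ENNReal.ofReal_mul (by positivity)]
    apply ENNReal.ofReal_le_ofReal
    have e : 1 / q - 1 / (q + δ) = δ / (q * (q + δ)) := by field_simp; ring
    rw [e, hK]
    have h6 : q + δ ≤ q * (1 + δ / q₀) := by
      have : δ ≤ q * (δ / q₀) := by
        rw [mul_div_assoc', le_div_iff₀ hq₀]; nlinarith
      linarith
    have h7 : (J + 1) * (1 + δ / q₀) / (δ * κ) * (κ * (δ / (q * (q + δ))))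
        = (J + 1) * (1 + δ / q₀) / (q * (q + δ)) := by
      field_simp
    rw [h7, div_le_div_iff₀ (by positivity) (by positivity)]
    have h8 : q * (q + δ) ≤ q * (q * (1 + δ / q₀)) := by gcongr
    have h9 : 0 ≤ q * (q * (1 + δ / q₀)) := by positivity
    nlinarith

lemma runs (M β : ℝ) (hM : 0 < M) (hβ0 : 0 < β) (hβ : β < 4) :
    ∃ m : ℕ, ∃ A : ℝ, ∀ p : ℕ → ℝ, (∀ t, 0 < p t) → Monotone p → ∀ t, A ≤ p t →
      (∀ s, t ≤ s → s < t + m → p (s + 2) ≤ p (s + 1) + M * (p (s + 1) / p s) ^ β) →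
      ∃ s, t ≤ s ∧ p (s + 1) ≤ 2 * p s := by
  set κ := 2 * Real.sqrt β - β with hκ
  have hsq : Real.sqrt β ^ 2 = β := Real.sq_sqrt hβ0.le
  have hs0 : 0 < Real.sqrt β := Real.sqrt_pos.2 hβ0
  have hs2 : Real.sqrt β < 2 := by
    rw [Real.sqrt_lt' (by norm_num)]; linarith
  have hκ0 : 0 < κ := by nlinarith
  set C := Real.log (2 * M) with hC
  obtain ⟨m, hm⟩ := exists_nat_gt (2 * β / κ + 2)
  refine ⟨m + 1, Real.exp (max 1 (2 * |C| / κ)), ?_⟩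
  intro p hp hmono t hA hrun
  by_contra hcon
  push Not at hcon
  set a : ℕ → ℝ := fun j => Real.log (p (t + j)) with ha
  have hamono : ∀ i j, i ≤ j → a i ≤ a j := fun i j hij =>
    Real.log_le_log (hp _) (hmono (by omega))
  have ha0 : max 1 (2 * |C| / κ) ≤ a 0 := by
    rw [ha]; simp only [add_zero]
    rw [Real.le_log_iff_exp_le (hp _)]; exact hA
  have haj : ∀ j, 1 ≤ a j := fun j => (le_max_left _ _).trans (ha0.trans (hamono 0 j (by omega)))
  have haC : ∀ j, C ≤ a j * (κ / 2) := fun j => by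
    have h1 : 2 * |C| / κ ≤ a j := (le_max_right _ _).trans (ha0.trans (hamono 0 j (by omega)))
    rw [div_le_iff₀ hκ0] at h1
    linarith [le_abs_self C]
  have hrec : ∀ j, j < m + 1 → a (j + 2) ≤ C + β * (a (j + 1) - a j) := by
    intro j hj
    have h1 := hrun (t + j) (by omega) (by omega)
    have h2 := hcon (t + j + 1) (by omega)
    have h3 : p (t + j + 2) ≤ 2 * M * (p (t + j + 1) / p (t + j)) ^ β := by
      have : p (t + j + 1 + 1) = p (t + j + 2) := rfl
      linarith
    have h4 := Real.log_le_log (hp _) h3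
    have hd : 0 < p (t + j + 1) / p (t + j) := div_pos (hp _) (hp _)
    rw [Real.log_mul (by positivity) (Real.rpow_pos_of_pos hd β).ne', Real.log_rpow hd,
      Real.log_div (hp _).ne' (hp _).ne'] at h4
    exact h4
  set x : ℕ → ℝ := fun j => a (j + 1) / a j with hx
  have hx1 : ∀ j, 1 ≤ x j := fun j => by
    rw [hx]; simp only
    rw [one_le_div (by linarith [haj j])]
    exact hamono _ _ (by omega)
  have hxrec : ∀ j, j < m + 1 → x (j + 1) ≤ β * (1 - 1 / x j) + κ / 2 := by
    intro j hj
    have hpos : 0 < a (j + 1) := by linarith [haj (j + 1)]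
    have hpos' : 0 < a j := by linarith [haj j]
    have e : x (j + 1) = a (j + 2) / a (j + 1) := rfl
    rw [e, div_le_iff₀ hpos]
    have e2 : (β * (1 - 1 / x j) + κ / 2) * a (j + 1) = β * (a (j + 1) - a j) + a (j + 1) * (κ / 2) := by
      rw [hx]; simp only; field_simp
    rw [e2]
    linarith [hrec j hj, haC (j + 1)]
  have hstep : ∀ y : ℝ, 1 ≤ y → β * (1 - 1 / y) ≤ y - κ := by
    intro y hy
    have hy0 : 0 < y := by linarith
    have : y - κ - β * (1 - 1 / y) = (y - Real.sqrt β) ^ 2 / y := by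
      rw [hκ]; field_simp; nlinarith
    have h2 : 0 ≤ (y - Real.sqrt β) ^ 2 / y := by positivity
    linarith
  have hind : ∀ j, j < m + 1 → x (j + 1) ≤ β + κ / 2 - j * (κ / 2) := by
    intro j
    induction j with
    | zero =>
      intro h
      have h1 := hxrec 0 h
      have h2 : 0 < 1 / x 0 := one_div_pos.2 (by linarith [hx1 0])
      push_cast
      nlinarith
    | succ j ih =>
      intro h
      have h1 := hxrec (j + 1) h
      have h2 := hstep _ (hx1 (j + 1))
      have h3 := ih (by omega)
      push_cast
      linarith
  have hf := hind m (by omega)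
  have hl := hx1 (m + 1)
  have h5 : 2 * β + 2 * κ < m * κ := by
    have := mul_lt_mul_of_pos_right hm hκ0
    rwa [add_mul, div_mul_cancel₀ _ hκ0.ne'] at this
  linarith

/-- Pathwise conclusion -/
lemma path_conclusion (M β A : ℝ) (m : ℕ)
    (hA : ∀ p : ℕ → ℝ, (∀ t, 0 < p t) → Monotone p → ∀ t, A ≤ p t →
      (∀ s, t ≤ s → s < t + m → p (s + 2) ≤ p (s + 1) + M * (p (s + 1) / p s) ^ β) →
      ∃ s, t ≤ s ∧ p (s + 1) ≤ 2 * p s)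
    (p : ℕ → ℝ) (hp : ∀ t, 0 < p t) (hmono : Monotone p)
    (hruns : ∀ N, ∃ t, N ≤ t ∧
      ∀ s, t ≤ s → s < t + m → p (s + 2) ≤ p (s + 1) + M * (p (s + 1) / p s) ^ β)
    (hexit : ∃ N, ∀ t, N ≤ t → p (t + 1) ≤ 2 * p t → p (t + 2) ≤ 2 * p (t + 1)) :
    ∃ N, ∀ t, N ≤ t → p (t + 1) ≤ 2 * p t := by
  obtain ⟨N, hN⟩ := hexit
  suffices h : ∃ s, N ≤ s ∧ p (s + 1) ≤ 2 * p s by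
    obtain ⟨s, hs, hs2⟩ := h
    refine ⟨s, fun t ht => ?_⟩
    induction t, ht using Nat.le_induction with
    | base => exact hs2
    | succ k hk ih => exact hN k (by omega) ih
  by_contra hcon
  push Not at hcon
  have hgrow : ∀ k, p N * 2 ^ k ≤ p (N + k) := by
    intro k
    induction k with
    | zero => simp
    | succ k ih =>
      have := hcon (N + k) (by omega)
      rw [pow_succ]
      have e : p (N + (k + 1)) = p (N + k + 1) := rfl
      linarith
  obtain ⟨k, hk⟩ := pow_unbounded_of_one_lt (A / p N) (one_lt_two (α := ℝ))
  rw [div_lt_iff₀ (hp N)] at hk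
  obtain ⟨t, ht, ht2⟩ := hruns (N + k)
  obtain ⟨s, hs, hs2⟩ := hA p hp hmono t
    (by linarith [hgrow k, hmono ht]) ht2
  exact absurd hs2 (not_le.2 (hcon s (by omega)))

lemma cond_lower {Ω : Type*} {m m0 : MeasurableSpace Ω} (hm : m ≤ m0) (P : Measure Ω)
    [IsProbabilityMeasure P] (G s : Set Ω) (hG : MeasurableSet[m] G) (hs : MeasurableSet[m0] s)
    (c : ℝ) (hc : 0 ≤ c)
    (h : ∀ A, MeasurableSet[m] A → ENNReal.ofReal c * P (A ∩ G) ≤ P (A ∩ s)) :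
    (G.indicator (fun _ => c)) ≤ᵐ[P] P[s.indicator (1 : Ω → ℝ) | m] := by
  have hsint : Integrable (s.indicator (1 : Ω → ℝ)) P :=
    (integrable_const (1 : ℝ)).indicator hs
  have hGint : Integrable (G.indicator (fun _ => c)) P :=
    (integrable_const c).indicator (hm _ hG)
  have hGm : StronglyMeasurable[m] (G.indicator (fun _ => c)) :=
    StronglyMeasurable.indicator stronglyMeasurable_const hG
  apply ae_le_of_ae_le_trim (hm := hm)
  apply ae_le_of_forall_setIntegral_le
  · exact hGint.trim hm hGm
  · exact integrable_condExp.trim hm stronglyMeasurable_condExp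
  · intro A hA _
    rw [← setIntegral_trim hm hGm hA, ← setIntegral_trim hm stronglyMeasurable_condExp hA,
      setIntegral_condExp hm hsint hA, setIntegral_indicator (hm _ hG), setIntegral_indicator hs]
    simp only [Pi.one_apply, setIntegral_const, smul_eq_mul, mul_one]
    have h1 := ENNReal.toReal_mono (measure_ne_top _ _) (h A hA)
    rw [ENNReal.toReal_mul, ENNReal.toReal_ofReal hc] at h1
    rw [mul_comm]
    exact h1

lemma io_step {Ω : Type*} {m0 : MeasurableSpace Ω} (P : Measure Ω)
    [IsProbabilityMeasure P] (ℱ : Filtration ℕ m0) (G s : ℕ → Set Ω)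
    (hG : ∀ n, MeasurableSet[ℱ n] (G n)) (hs : ∀ n, MeasurableSet[ℱ n] (s n))
    (c : ℝ) (hc : 0 < c)
    (h : ∀ n A, MeasurableSet[ℱ n] A → ENNReal.ofReal c * P (A ∩ G n) ≤ P (A ∩ s (n + 1)))
    (h_freq : ∀ᵐ ω ∂P, ∃ᶠ n in atTop, ω ∈ G n) :
    ∀ᵐ ω ∂P, ∃ᶠ n in atTop, ω ∈ s n := by
  have h1 := ae_mem_limsup_atTop_iff (ℱ := ℱ) P hs
  have h2 : ∀ᵐ ω ∂P, ∀ n, (G n).indicator (fun _ => c) ω ≤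
      (P[(s (n + 1)).indicator (1 : Ω → ℝ) | ℱ n]) ω := by
    rw [ae_all_iff]
    intro n
    exact cond_lower (ℱ.le n) P (G n) (s (n + 1)) (hG n) (ℱ.le _ _ (hs (n + 1))) c hc.le (h n)
  filter_upwards [h1, h2, h_freq] with ω h1 h2 h3
  rw [← mem_limsup_iff_frequently_mem, h1]
  have h4 : ω ∈ limsup G atTop := mem_limsup_iff_frequently_mem.2 h3
  rw [Set.limsup_eq_tendsto_sum_indicator_atTop hc] at h4
  exact tendsto_atTop_mono (fun n => Finset.sum_le_sum fun k _ => h2 k) h4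

/-- `p_t` along a path. -/
noncomputable def pf (f : ℝ → ℝ) (p₀ : ℝ) (z : ℕ → ℝ) (t : ℕ) : ℝ :=
  p₀ + ∑ i ∈ Finset.range t, f (z i) ^ 2

lemma pf_succ (f : ℝ → ℝ) (p₀ : ℝ) (z : ℕ → ℝ) (t : ℕ) :
    pf f p₀ z (t + 1) = pf f p₀ z t + f (z t) ^ 2 := by
  unfold pf; rw [Finset.sum_range_succ]; ring

lemma pf_ge (f : ℝ → ℝ) (p₀ : ℝ) (z : ℕ → ℝ) (t : ℕ) : p₀ ≤ pf f p₀ z t := by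
  unfold pf
  have : 0 ≤ ∑ i ∈ Finset.range t, f (z i) ^ 2 := Finset.sum_nonneg fun i _ => sq_nonneg _
  linarith

lemma pf_mono (f : ℝ → ℝ) (p₀ : ℝ) (z : ℕ → ℝ) : Monotone (pf f p₀ z) :=
  monotone_nat_of_le_succ fun t => by rw [pf_succ]; nlinarith [sq_nonneg (f (z t))]

lemma pf_meas (f : ℝ → ℝ) (hf : Measurable f) (p₀ : ℝ) (t : ℕ) :
    Measurable (fun z : ℕ → ℝ => pf f p₀ z t) := by
  unfold pf; fun_prop

lemma pf_congr (f : ℝ → ℝ) (p₀ : ℝ) (z z' : ℕ → ℝ) (t : ℕ) (h : ∀ i, i < t → z i = z' i) :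
    pf f p₀ z t = pf f p₀ z' t := by
  unfold pf; congr 1
  exact Finset.sum_congr rfl fun i hi => by rw [h i (Finset.mem_range.1 hi)]

/-- stopped path. -/
def Hst {Ω : Type*} (y : ℕ → Ω → ℝ) (t : ℕ) (ω : Ω) : ℕ → ℝ := fun i => y (min i t) ω

lemma Hst_meas {Ω : Type*} [MeasurableSpace Ω] (y : ℕ → Ω → ℝ) (hy : ∀ t, Measurable (y t))
    (t : ℕ) : Measurable (Hst y t) := by
  rw [measurable_pi_iff]; intro i; exact hy _

lemma pf_Hst {Ω : Type*} (f : ℝ → ℝ) (p₀ : ℝ) (y : ℕ → Ω → ℝ) (t s : ℕ) (hs : s ≤ t + 1) (ω : Ω) :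
    pf f p₀ (Hst y t ω) s = pf f p₀ (fun i => y i ω) s := by
  apply pf_congr
  intro i hi
  show y (min i t) ω = y i ω
  rw [min_eq_left (by omega)]

/-- history filtration. -/
def Fil {Ω : Type*} [m0 : MeasurableSpace Ω] (y : ℕ → Ω → ℝ) (hy : ∀ t, Measurable (y t)) :
    Filtration ℕ m0 where
  seq t := MeasurableSpace.comap (Hst y t) inferInstance
  mono' := by
    intro s t hst
    have e : Hst y s = (fun (z : ℕ → ℝ) (i : ℕ) => z (min i s)) ∘ Hst y t := by
      funext ω i
      simp only [Hst, Function.comp]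
      congr 1
      omega
    show MeasurableSpace.comap (Hst y s) _ ≤ MeasurableSpace.comap (Hst y t) _
    rw [e, ← MeasurableSpace.comap_comp]
    apply MeasurableSpace.comap_mono
    have : Measurable (fun (z : ℕ → ℝ) (i : ℕ) => z (min i s)) := by fun_prop
    exact this.comap_le
  le' t := (Hst_meas y hy t).comap_le

lemma lint_indep {Ω E : Type*} [MeasurableSpace Ω] [MeasurableSpace E] (P : Measure Ω)
    [IsProbabilityMeasure P] (H : Ω → E) (hH : Measurable H) (ξ : Ω → ℝ) (hξ : Measurable ξ)
    (hl : P.map ξ = gaussianReal 0 1) (hi : IndepFun H ξ P) (Φ : E → ℝ → ENNReal)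
    (hΦ : Measurable (Function.uncurry Φ)) :
    ∫⁻ ω, Φ (H ω) (ξ ω) ∂P = ∫⁻ h, ∫⁻ x, Φ h x ∂(gaussianReal 0 1) ∂(P.map H) := by
  have e := (indepFun_iff_map_prod_eq_prod_map_map hH.aemeasurable hξ.aemeasurable).1 hi
  have := Measure.isProbabilityMeasure_map (μ := P) hH.aemeasurable
  rw [hl] at e
  have h2 := lintegral_prod (μ := P.map H) (ν := gaussianReal 0 1) _ hΦ.aemeasurable
  rw [← e, lintegral_map hΦ (by fun_prop)] at h2
  exact h2

lemma meas_indep {Ω E : Type*} [MeasurableSpace Ω] [MeasurableSpace E] (P : Measure Ω)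
    [IsProbabilityMeasure P] (H : Ω → E) (hH : Measurable H) (ξ : Ω → ℝ) (hξ : Measurable ξ)
    (hl : P.map ξ = gaussianReal 0 1) (hi : IndepFun H ξ P) (T : Set (E × ℝ))
    (hT : MeasurableSet T) :
    P {ω | (H ω, ξ ω) ∈ T} = ∫⁻ h, gaussianReal 0 1 {x | (h, x) ∈ T} ∂(P.map H) := by
  have e := (indepFun_iff_map_prod_eq_prod_map_map hH.aemeasurable hξ.aemeasurable).1 hi
  have := Measure.isProbabilityMeasure_map (μ := P) hH.aemeasurable
  rw [hl] at e
  have h2 := Measure.prod_apply (μ := P.map H) (ν := gaussianReal 0 1) hT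
  rw [← e, Measure.map_apply (by fun_prop) hT] at h2
  exact h2

/-- Runs of landings. -/
def Gm {Ω : Type*} (Land : ℕ → Set Ω) : ℕ → ℕ → Set Ω
  | 0, _ => Set.univ
  | _ + 1, 0 => ∅
  | k + 1, n + 1 => Gm Land k n ∩ Land n

lemma Gm_spec {Ω : Type*} (Land : ℕ → Set Ω) (k n : ℕ) (ω : Ω) (h : ω ∈ Gm Land k n) :
    k ≤ n ∧ ∀ s, n - k ≤ s → s < n → ω ∈ Land s := by
  induction k generalizing n with
  | zero => exact ⟨by omega, fun s h1 h2 => absurd h2 (by omega)⟩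
  | succ k ih =>
    cases n with
    | zero => exact absurd h (Set.notMem_empty _)
    | succ n =>
      have h' : ω ∈ Gm Land k n ∩ Land n := h
      obtain ⟨h1, h2⟩ := ih n h'.1
      refine ⟨by omega, fun s hs1 hs2 => ?_⟩
      rcases Nat.lt_succ_iff_lt_or_eq.1 hs2 with h3 | h3
      · exact h2 s (by omega) h3
      · rw [h3]; exact h'.2

lemma Gm_meas {Ω : Type*} {m0 : MeasurableSpace Ω} (ℱ : Filtration ℕ m0) (Land : ℕ → Set Ω)
    (hL : ∀ n, MeasurableSet[ℱ (n + 1)] (Land n)) (k n : ℕ) : MeasurableSet[ℱ n] (Gm Land k n) := by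
  induction k generalizing n with
  | zero => exact @MeasurableSet.univ _ (ℱ n)
  | succ k ih =>
    cases n with
    | zero => exact @MeasurableSet.empty _ (ℱ 0)
    | succ n => exact (ℱ.mono (Nat.le_succ n) _ (ih n)).inter (hL n)

section core

lemma core_runs {Ω : Type*} [mΩ : MeasurableSpace Ω] (P : Measure Ω) [IsProbabilityMeasure P]
    (f : ℝ → ℝ) (hf : Measurable f) (p₀ : ℝ) (hp₀ : 0 < p₀) (y : ℕ → Ω → ℝ)
    (hym : ∀ t, Measurable (y t)) (ξ : ℕ → Ω → ℝ) (hξm : ∀ t, Measurable (ξ t))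
    (hξ : ∀ t, P.map (ξ t) = gaussianReal 0 1)
    (hind : ∀ t, IndepFun (Hst y t) (ξ t) P)
    (hy : ∀ t ω, y (t + 1) ω = Real.sqrt (pf f p₀ (fun i => y i ω) (t + 1) /
      pf f p₀ (fun i => y i ω) t) * ξ t ω)
    (c M β : ℝ) (hc : 0 < c)
    (hland : ∀ r : ℝ, 1 ≤ r →
      ENNReal.ofReal c ≤ gaussianReal 0 1 {x | f (Real.sqrt r * x) ^ 2 ≤ M * r ^ β}) (m : ℕ) :
    ∀ᵐ ω ∂P, ∀ N, ∃ t, N ≤ t ∧ ∀ s, t ≤ s → s < t + m →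
      pf f p₀ (fun i => y i ω) (s + 2) ≤ pf f p₀ (fun i => y i ω) (s + 1) +
        M * (pf f p₀ (fun i => y i ω) (s + 1) / pf f p₀ (fun i => y i ω) s) ^ β := by
  have hpm := pf_meas f hf p₀
  set Land : ℕ → Set Ω := fun n => {ω | f (y (n + 1) ω) ^ 2 ≤
    M * (pf f p₀ (fun i => y i ω) (n + 1) / pf f p₀ (fun i => y i ω) n) ^ β} with hLand
  have hLm : ∀ n, MeasurableSet[Fil y hym (n + 1)] (Land n) := by
    intro n
    refine ⟨{z | f (z (n + 1)) ^ 2 ≤ M * (pf f p₀ z (n + 1) / pf f p₀ z n) ^ β}, ?_, ?_⟩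
    · apply measurableSet_le
      · fun_prop
      · exact (((hpm (n + 1)).div (hpm n)).pow_const β).const_mul M
    · ext ω
      simp only [Set.mem_preimage, Set.mem_ofPred_eq, hLand]
      rw [pf_Hst f p₀ y _ _ (by omega), pf_Hst f p₀ y _ _ (by omega)]
      simp [Hst]
  have h_freq : ∀ k, ∀ᵐ ω ∂P, ∃ᶠ n in atTop, ω ∈ Gm Land k n := by
    intro k
    induction k with
    | zero =>
      refine ae_of_all _ fun ω => ?_
      simp only [Gm, Set.mem_univ]
      exact frequently_true_iff_neBot _ |>.2 inferInstance
    | succ k ih =>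
      refine io_step P (Fil y hym) (Gm Land k) (Gm Land (k + 1)) (Gm_meas _ _ hLm k)
        (Gm_meas _ _ hLm (k + 1)) c hc ?_ ih
      intro n A hA
      obtain ⟨B', hB', hB⟩ := hA.inter (Gm_meas _ _ hLm k n)
      show _ ≤ P (A ∩ (Gm Land k n ∩ Land n))
      rw [← Set.inter_assoc, ← hB]
      set T : Set ((ℕ → ℝ) × ℝ) := {q | q.1 ∈ B' ∧
        f (Real.sqrt (pf f p₀ q.1 (n + 1) / pf f p₀ q.1 n) * q.2) ^ 2 ≤
          M * (pf f p₀ q.1 (n + 1) / pf f p₀ q.1 n) ^ β} with hT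
      have hq1 : Measurable fun q : (ℕ → ℝ) × ℝ => pf f p₀ q.1 (n + 1) / pf f p₀ q.1 n :=
        ((hpm (n + 1)).div (hpm n)).comp measurable_fst
      have hTm : MeasurableSet T := by
        have hT2 : MeasurableSet {q : (ℕ → ℝ) × ℝ |
            f (Real.sqrt (pf f p₀ q.1 (n + 1) / pf f p₀ q.1 n) * q.2) ^ 2 ≤
            M * (pf f p₀ q.1 (n + 1) / pf f p₀ q.1 n) ^ β} := by
          apply measurableSet_le
          · fun_prop
          · exact (hq1.pow_const β).const_mul M
        exact (measurable_fst hB').inter hT2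
      have e1 : Hst y n ⁻¹' B' ∩ Land n = {ω | (Hst y n ω, ξ n ω) ∈ T} := by
        ext ω
        simp only [hT, hLand, Set.mem_inter_iff, Set.mem_preimage, Set.mem_ofPred_eq]
        rw [pf_Hst f p₀ y _ _ (by omega), pf_Hst f p₀ y _ _ (by omega), hy n ω]
      rw [e1, meas_indep P (Hst y n) (Hst_meas y hym n) (ξ n) (hξm n) (hξ n) (hind n) T hTm,
        ← Measure.map_apply (Hst_meas y hym n) hB', ← setLIntegral_const,
        ← lintegral_indicator hB']
      apply lintegral_mono
      intro h
      by_cases hh : h ∈ B'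
      · rw [Set.indicator_of_mem hh]
        have hr : 1 ≤ pf f p₀ h (n + 1) / pf f p₀ h n := by
          rw [one_le_div (lt_of_lt_of_le hp₀ (pf_ge _ _ _ _))]
          exact pf_mono _ _ _ (Nat.le_succ n)
        refine (hland _ hr).trans (le_of_eq ?_)
        congr 1
        ext x
        simp [hT, hh]
      · rw [Set.indicator_of_notMem hh]; exact zero_le
  filter_upwards [h_freq m] with ω hω N
  obtain ⟨n, hn, hn2⟩ := frequently_atTop.1 hω (N + m)
  obtain ⟨h1, h2⟩ := Gm_spec Land m n ω hn2
  refine ⟨n - m, by omega, fun s hs1 hs2 => ?_⟩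
  have h3 : ω ∈ Land s := h2 s hs1 (by omega)
  rw [pf_succ f p₀ _ (s + 1)]
  have h4 : f (y (s + 1) ω) ^ 2 ≤ _ := h3
  linarith

lemma core_exit {Ω : Type*} [mΩ : MeasurableSpace Ω] (P : Measure Ω) [IsProbabilityMeasure P]
    (f : ℝ → ℝ) (hf : Measurable f) (p₀ : ℝ) (hp₀ : 0 < p₀) (y : ℕ → Ω → ℝ)
    (hym : ∀ t, Measurable (y t)) (ξ : ℕ → Ω → ℝ) (hξm : ∀ t, Measurable (ξ t))
    (hξ : ∀ t, P.map (ξ t) = gaussianReal 0 1)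
    (hind : ∀ t, IndepFun (Hst y t) (ξ t) P)
    (hy : ∀ t ω, y (t + 1) ω = Real.sqrt (pf f p₀ (fun i => y i ω) (t + 1) /
      pf f p₀ (fun i => y i ω) t) * ξ t ω)
    (K : ℝ)
    (hstar : ∀ r q : ℝ, 1 ≤ r → r ≤ 2 → p₀ ≤ q →
      gaussianReal 0 1 {x | q < f (Real.sqrt r * x) ^ 2} ≤
        ENNReal.ofReal K *
          ∫⁻ x, ENNReal.ofReal (1 / q - 1 / (q + f (Real.sqrt r * x) ^ 2)) ∂(gaussianReal 0 1)) :
    ∀ᵐ ω ∂P, ∃ N, ∀ t, N ≤ t →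
      pf f p₀ (fun i => y i ω) (t + 1) ≤ 2 * pf f p₀ (fun i => y i ω) t →
      pf f p₀ (fun i => y i ω) (t + 2) ≤ 2 * pf f p₀ (fun i => y i ω) (t + 1) := by
  have hpm := pf_meas f hf p₀
  have hpos : ∀ z t, 0 < pf f p₀ z t := fun z t => lt_of_lt_of_le hp₀ (pf_ge _ _ _ _)
  set D : ℕ → Set Ω := fun t => {ω | pf f p₀ (fun i => y i ω) (t + 1) ≤ 2 * pf f p₀ (fun i => y i ω) t ∧
    2 * pf f p₀ (fun i => y i ω) (t + 1) < pf f p₀ (fun i => y i ω) (t + 2)} with hD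
  set v : ℕ → Ω → ℝ := fun t ω => 1 / pf f p₀ (fun i => y i ω) (t + 1) with hv
  have hvm : ∀ t, Measurable (v t) := fun t => by
    have : Measurable fun ω => pf f p₀ (fun i => y i ω) (t + 1) :=
      (hpm (t + 1)).comp (measurable_pi_iff.2 hym)
    exact measurable_const.div this
  have hDb : ∀ t, P (D t) ≤ ENNReal.ofReal K * ∫⁻ ω, ENNReal.ofReal (v t ω - v (t + 1) ω) ∂P := by
    intro t
    have hq0 : Measurable fun q : (ℕ → ℝ) × ℝ => pf f p₀ q.1 t := (hpm t).comp measurable_fst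
    have hq1 : Measurable fun q : (ℕ → ℝ) × ℝ => pf f p₀ q.1 (t + 1) :=
      (hpm (t + 1)).comp measurable_fst
    set T : Set ((ℕ → ℝ) × ℝ) := {q | pf f p₀ q.1 (t + 1) ≤ 2 * pf f p₀ q.1 t ∧
      pf f p₀ q.1 (t + 1) < f (Real.sqrt (pf f p₀ q.1 (t + 1) / pf f p₀ q.1 t) * q.2) ^ 2} with hT
    have hTm : MeasurableSet T := by
      apply MeasurableSet.inter
      · exact measurableSet_le hq1 (by fun_prop)
      · exact measurableSet_lt hq1 (by fun_prop)
    have e1 : D t = {ω | (Hst y t ω, ξ t ω) ∈ T} := by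
      ext ω
      simp only [hT, hD, Set.mem_ofPred_eq]
      rw [pf_Hst f p₀ y _ _ (by omega), pf_Hst f p₀ y _ _ (by omega), ← hy t ω,
        pf_succ f p₀ _ (t + 1)]
      constructor <;> rintro ⟨h1, h2⟩ <;> exact ⟨h1, by linarith⟩
    set Φ : (ℕ → ℝ) → ℝ → ENNReal := fun h x => ENNReal.ofReal (1 / pf f p₀ h (t + 1) -
      1 / (pf f p₀ h (t + 1) + f (Real.sqrt (pf f p₀ h (t + 1) / pf f p₀ h t) * x) ^ 2)) with hΦ
    have hΦm : Measurable (Function.uncurry Φ) := by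
      unfold Function.uncurry
      simp only [hΦ]
      fun_prop
    have e2 : ∫⁻ ω, ENNReal.ofReal (v t ω - v (t + 1) ω) ∂P = ∫⁻ ω, Φ (Hst y t ω) (ξ t ω) ∂P := by
      apply lintegral_congr
      intro ω
      simp only [hΦ, hv]
      rw [pf_Hst f p₀ y _ _ (by omega), pf_Hst f p₀ y _ _ (by omega), ← hy t ω,
        pf_succ f p₀ _ (t + 1)]
    rw [e1, e2, meas_indep P (Hst y t) (Hst_meas y hym t) (ξ t) (hξm t) (hξ t) (hind t) T hTm,
      lint_indep P (Hst y t) (Hst_meas y hym t) (ξ t) (hξm t) (hξ t) (hind t) Φ hΦm,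
      ← lintegral_const_mul' _ _ ENNReal.ofReal_ne_top]
    apply lintegral_mono
    intro h
    by_cases hh : pf f p₀ h (t + 1) ≤ 2 * pf f p₀ h t
    · refine le_trans (le_of_eq ?_) (hstar (pf f p₀ h (t + 1) / pf f p₀ h t) (pf f p₀ h (t + 1))
        ?_ ?_ (pf_ge _ _ _ _))
      · have : {x : ℝ | (h, x) ∈ T} = {x | pf f p₀ h (t + 1) <
            f (Real.sqrt (pf f p₀ h (t + 1) / pf f p₀ h t) * x) ^ 2} := by
          ext x; simp [hT, hh]
        exact congrArg (gaussianReal 0 1) this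
      · rw [one_le_div (hpos _ _)]
        exact pf_mono _ _ _ (Nat.le_succ t)
      · rw [div_le_iff₀ (hpos _ _)]; exact hh
    · have : {x : ℝ | (h, x) ∈ T} = ∅ := by
        ext x; simp [hT, hh]
      simp [this]
  have hsum : ∑' t, P (D t) ≠ ⊤ := by
    have h1 : ∑' t, P (D t) ≤ ENNReal.ofReal K * ENNReal.ofReal (1 / p₀) := by
      calc ∑' t, P (D t) ≤ ∑' t, ENNReal.ofReal K * ∫⁻ ω, ENNReal.ofReal (v t ω - v (t + 1) ω) ∂P :=
            ENNReal.tsum_le_tsum hDb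
        _ = ENNReal.ofReal K * ∫⁻ ω, ∑' t, ENNReal.ofReal (v t ω - v (t + 1) ω) ∂P := by
            rw [ENNReal.tsum_mul_left, lintegral_tsum]
            intro t
            exact (((hvm t).sub (hvm (t + 1))).ennreal_ofReal).aemeasurable
        _ ≤ ENNReal.ofReal K * ∫⁻ ω, ENNReal.ofReal (1 / p₀) ∂P := by
            gcongr with ω
            apply ENNReal.tsum_le_of_sum_range_le
            intro n
            rw [← ENNReal.ofReal_sum_of_nonneg, Finset.sum_range_sub' (fun i => v i ω)]
            · apply ENNReal.ofReal_le_ofReal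
              have : 0 ≤ v n ω := by simp only [hv]; exact (one_div_pos.2 (hpos _ _)).le
              have h2 : v 0 ω ≤ 1 / p₀ := one_div_le_one_div_of_le hp₀ (pf_ge _ _ _ _)
              linarith
            · intro i _
              rw [sub_nonneg]
              exact one_div_le_one_div_of_le (hpos _ _) (pf_mono _ _ _ (Nat.le_succ _))
        _ = _ := by simp
    exact ne_top_of_le_ne_top (ENNReal.mul_ne_top ENNReal.ofReal_ne_top ENNReal.ofReal_ne_top) h1
  filter_upwards [ae_eventually_notMem hsum] with ω hω
  obtain ⟨N, hN⟩ := eventually_atTop.1 hω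
  refine ⟨N, fun t ht h1 => ?_⟩
  by_contra h2
  exact hN t ht ⟨h1, not_le.1 h2⟩

lemma core_slln {Ω : Type*} [mΩ : MeasurableSpace Ω] (P : Measure Ω) [IsProbabilityMeasure P]
    (f : ℝ → ℝ) (hf : Measurable f) (p₀ : ℝ) (hp₀ : 0 < p₀) (y : ℕ → Ω → ℝ)
    (hym : ∀ t, Measurable (y t)) (ξ : ℕ → Ω → ℝ) (hξm : ∀ t, Measurable (ξ t))
    (hξ : ∀ t, P.map (ξ t) = gaussianReal 0 1)
    (hind : ∀ t, IndepFun (Hst y t) (ξ t) P)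
    (hy : ∀ t ω, y (t + 1) ω = Real.sqrt (pf f p₀ (fun i => y i ω) (t + 1) /
      pf f p₀ (fun i => y i ω) t) * ξ t ω)
    : ∀ᵐ ω ∂P, ∃ B : ℝ, ∀ t : ℕ, (∑ i ∈ Finset.range t, ξ i ω ^ 2) / t ≤ B := by
  have hpm := pf_meas f hf p₀
  have hpos : ∀ z t, 0 < pf f p₀ z t := fun z t => lt_of_lt_of_le hp₀ (pf_ge _ _ _ _)
  have hpair : ∀ i j, i < j → IndepFun (ξ i) (ξ j) P := by
    intro i j hij
    have e : ξ i = (fun z : ℕ → ℝ => z (i + 1) / Real.sqrt (pf f p₀ z (i + 1) / pf f p₀ z i)) ∘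
        Hst y j := by
      funext ω
      simp only [Function.comp]
      rw [pf_Hst f p₀ y _ _ (by omega), pf_Hst f p₀ y _ _ (by omega)]
      have : Hst y j ω (i + 1) = y (i + 1) ω := by
        simp only [Hst]; rw [min_eq_left (by omega)]
      rw [this, hy i ω, mul_div_cancel_left₀]
      exact (Real.sqrt_pos.2 (div_pos (hpos _ _) (hpos _ _))).ne'
    rw [e]
    have hm : Measurable (fun z : ℕ → ℝ => z (i + 1) / Real.sqrt (pf f p₀ z (i + 1) / pf f p₀ z i)) :=
      (measurable_pi_apply _).div (((hpm (i + 1)).div (hpm i)).sqrt)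
    exact (hind j).comp hm measurable_id
  have hid : ∀ i, IdentDistrib (fun ω => ξ i ω ^ 2) (fun ω => ξ 0 ω ^ 2) P P := by
    intro i
    have : IdentDistrib (ξ i) (ξ 0) P P :=
      ⟨(hξm i).aemeasurable, (hξm 0).aemeasurable, by rw [hξ, hξ]⟩
    exact this.comp (measurable_id.pow_const 2)
  have hintg : Integrable (fun ω => ξ 0 ω ^ 2) P := by
    have h1 : Integrable (fun x : ℝ => x ^ 2) (P.map (ξ 0)) := by
      rw [hξ]
      exact (memLp_id_gaussianReal 2).integrable_sq
    exact (integrable_map_measure (by fun_prop) (hξm 0).aemeasurable).1 h1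
  have hs := strong_law_ae_real (fun i ω => ξ i ω ^ 2) hintg (by
    intro i j hij
    have hp : IndepFun (ξ i) (ξ j) P := by
      rcases lt_or_gt_of_ne hij with h | h
      · exact hpair i j h
      · exact (hpair j i h).symm
    exact hp.comp (measurable_id.pow_const 2) (measurable_id.pow_const 2)) hid
  filter_upwards [hs] with ω hω
  obtain ⟨B, hB⟩ := hω.bddAbove_range
  exact ⟨B, fun t => hB ⟨t, rfl⟩⟩

lemma core {Ω : Type*} [mΩ : MeasurableSpace Ω] (P : Measure Ω) [IsProbabilityMeasure P]
    (f : ℝ → ℝ) (hf : Measurable f) (p₀ : ℝ) (hp₀ : 0 < p₀) (y : ℕ → Ω → ℝ)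
    (hym : ∀ t, Measurable (y t)) (ξ : ℕ → Ω → ℝ) (hξm : ∀ t, Measurable (ξ t))
    (hξ : ∀ t, P.map (ξ t) = gaussianReal 0 1)
    (hind : ∀ t, IndepFun (Hst y t) (ξ t) P)
    (hy : ∀ t ω, y (t + 1) ω = Real.sqrt (pf f p₀ (fun i => y i ω) (t + 1) /
      pf f p₀ (fun i => y i ω) t) * ξ t ω)
    (k₁ k₂ : ℝ) (hk₁ : 0 < k₁) (hk₂ : 0 < k₂)
    (hfgrow : ∀ x : ℝ, |f x| ≤ k₁ * Real.exp (k₂ * |x|))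
    (b L : ℝ) (hb : b < 4) (hL : 0 < L)
    (hliminf : 0 < Filter.liminf (fun l : ℝ =>
      (volume ({x : ℝ | |f x| < L * |x| ^ b} ∩ Set.Icc (-l) l)).toReal / l)
      Filter.atTop) :
    ∀ᵐ ω ∂P, ∃ M : ℝ, ∀ t : ℕ, 1 ≤ t →
          (∑ i ∈ Finset.Icc 1 t, (y i ω) ^ 2) / t ≤ M := by
  obtain ⟨c, M, β, hc, hM, hβ0, hβ4, hland⟩ := landing f hf k₁ k₂ hk₁ hk₂ hfgrow b L hb hL hliminf
  obtain ⟨K, hK, hstar⟩ := star f hf k₁ k₂ hk₁ hk₂ hfgrow p₀ hp₀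
  obtain ⟨m, A, hA⟩ := runs M β hM hβ0 hβ4
  have hpos : ∀ z t, 0 < pf f p₀ z t := fun z t => lt_of_lt_of_le hp₀ (pf_ge _ _ _ _)
  filter_upwards [core_runs P f hf p₀ hp₀ y hym ξ hξm hξ hind hy c M β hc hland m,
    core_exit P f hf p₀ hp₀ y hym ξ hξm hξ hind hy K hstar,
    core_slln P f hf p₀ hp₀ y hym ξ hξm hξ hind hy] with ω h1 h2 h3
  obtain ⟨N, hN⟩ := path_conclusion M β A m hA (pf f p₀ (fun i => y i ω)) (hpos _)
    (pf_mono _ _ _) h1 h2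
  obtain ⟨B, hB⟩ := h3
  refine ⟨∑ i ∈ Finset.range N, y (i + 1) ω ^ 2 + 2 * B, fun t ht => ?_⟩
  have e : ∑ i ∈ Finset.Icc 1 t, (y i ω) ^ 2 = ∑ i ∈ Finset.range t, y (i + 1) ω ^ 2 := by
    rw [Finset.range_eq_Ico, Finset.sum_Ico_add' (fun i => y i ω ^ 2) 0 t 1]
    rfl
  have hS0 : 0 ≤ ∑ i ∈ Finset.range N, y (i + 1) ω ^ 2 := Finset.sum_nonneg fun _ _ => sq_nonneg _
  have h4 : ∑ i ∈ Finset.range t, y (i + 1) ω ^ 2 ≤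
      ∑ i ∈ Finset.range N, y (i + 1) ω ^ 2 + 2 * ∑ i ∈ Finset.range t, ξ i ω ^ 2 := by
    calc ∑ i ∈ Finset.range t, y (i + 1) ω ^ 2 ≤
        ∑ i ∈ Finset.range t, ((if i < N then y (i + 1) ω ^ 2 else 0) + 2 * ξ i ω ^ 2) := by
          apply Finset.sum_le_sum
          intro i _
          split_ifs with h
          · nlinarith [sq_nonneg (ξ i ω)]
          · rw [hy i ω, mul_pow, Real.sq_sqrt (div_pos (hpos _ _) (hpos _ _)).le, zero_add]
            gcongr
            rw [div_le_iff₀ (hpos _ _)]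
            exact hN i (by omega)
      _ = ∑ i ∈ Finset.range t, (if i < N then y (i + 1) ω ^ 2 else 0) +
          2 * ∑ i ∈ Finset.range t, ξ i ω ^ 2 := by
          rw [Finset.sum_add_distrib, Finset.mul_sum]
      _ ≤ _ := by
          gcongr
          rw [← Finset.sum_filter]
          apply Finset.sum_le_sum_of_subset_of_nonneg
          · intro i hi
            simp only [Finset.mem_filter] at hi
            exact Finset.mem_range.2 hi.2
          · intro _ _ _; positivity
  have ht0 : (0 : ℝ) < t := by exact_mod_cast ht
  have ht1 : (1 : ℝ) ≤ t := by exact_mod_cast ht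
  have h5 := hB t
  rw [div_le_iff₀ ht0] at h5
  rw [e, div_le_iff₀ ht0]
  nlinarith

end core

/-- Least squares estimate along a path. -/
noncomputable def thh (f : ℝ → ℝ) (p₀ θ₀ : ℝ) (z : ℕ → ℝ) (t : ℕ) : ℝ :=
  θ₀ + ∑ i ∈ Finset.range t, f (z i) * z (i + 1) / pf f p₀ z (i + 1)

lemma thh_congr (f : ℝ → ℝ) (p₀ θ₀ : ℝ) (z z' : ℕ → ℝ) (t : ℕ) (h : ∀ i, i ≤ t → z i = z' i) :
    thh f p₀ θ₀ z t = thh f p₀ θ₀ z' t := by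
  unfold thh; congr 1
  refine Finset.sum_congr rfl fun i hi => ?_
  have hi' := Finset.mem_range.1 hi
  rw [h i (by omega), h (i + 1) (by omega), pf_congr f p₀ z z' (i + 1) (fun j hj => h j (by omega))]

lemma thh_meas (f : ℝ → ℝ) (hf : Measurable f) (p₀ θ₀ : ℝ) (t : ℕ) :
    Measurable (fun z : ℕ → ℝ => thh f p₀ θ₀ z t) := by
  unfold thh
  refine measurable_const.add (Finset.measurable_sum _ fun i _ => ?_)
  have := pf_meas f hf p₀ (i + 1)
  fun_prop

/-- extension by zero. -/
noncomputable def extz (t : ℕ) (x : Fin (t + 1) → ℝ) : ℕ → ℝ :=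
  fun i => if h : i < t + 1 then x ⟨i, h⟩ else 0

lemma extz_meas (t : ℕ) : Measurable (extz t) := by
  rw [measurable_pi_iff]
  intro i
  unfold extz
  split_ifs with h
  · exact measurable_pi_apply _
  · exact measurable_const

/-- The control law. -/
noncomputable def ctl (f : ℝ → ℝ) (p₀ θ₀ : ℝ) (t : ℕ) (x : Fin (t + 1) → ℝ) : ℝ :=
  -(thh f p₀ θ₀ (extz t x) t * f (extz t x t))

lemma ctl_meas (f : ℝ → ℝ) (hf : Measurable f) (p₀ θ₀ : ℝ) (t : ℕ) :
    Measurable (ctl f p₀ θ₀ t) := by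
  have h1 := (thh_meas f hf p₀ θ₀ t).comp (extz_meas t)
  have h2 := hf.comp ((measurable_pi_apply t).comp (extz_meas t))
  exact (h1.mul h2).neg

lemma ctl_eq (f : ℝ → ℝ) (p₀ θ₀ : ℝ) (t : ℕ) (z : ℕ → ℝ) :
    ctl f p₀ θ₀ t (fun i => z i) = -(thh f p₀ θ₀ z t * f (z t)) := by
  have h : ∀ i, i ≤ t → extz t (fun i => z i) i = z i := by
    intro i hi
    simp [extz, Nat.lt_succ_of_le hi]
  unfold ctl
  rw [thh_congr f p₀ θ₀ _ z t h, h t le_rfl]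

/-- normalized estimation error. -/
noncomputable def eta {Ω : Type*} (f : ℝ → ℝ) (p₀ θ₀ : ℝ) (θ : Ω → ℝ) (y : ℕ → Ω → ℝ) (t : ℕ)
    (ω : Ω) : ℝ :=
  Real.sqrt (pf f p₀ (Hst y t ω) t) * (θ ω - thh f p₀ θ₀ (Hst y t ω) t)

lemma all_meas {Ω : Type*} [MeasurableSpace Ω] (f : ℝ → ℝ) (hf : Measurable f) (p₀ θ₀ y₀ : ℝ)
    (θ : Ω → ℝ) (hθ : Measurable θ) (w : ℕ → Ω → ℝ) (t : ℕ)
    (hw : ∀ s, s < t → Measurable (w (s + 1))) (y : ℕ → Ω → ℝ) (hy0 : ∀ ω, y 0 ω = y₀)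
    (hy : ∀ t ω, y (t + 1) ω = θ ω * f (y t ω) + ctl f p₀ θ₀ t (fun i => y i ω) + w (t + 1) ω) :
    (∀ s, s ≤ t → Measurable (y s)) ∧
    Measurable (fun ω => (Hst y t ω, eta f p₀ θ₀ θ y t ω)) := by
  have h1 : ∀ s, s ≤ t → Measurable (y s) := by
    intro s
    induction s using Nat.strong_induction_on with
    | _ s ih =>
      cases s with
      | zero =>
        intro _
        have : y 0 = fun _ => y₀ := funext hy0
        rw [this]; exact measurable_const
      | succ s =>
        intro hs
        have e : y (s + 1) = fun ω => θ ω * f (y s ω) + ctl f p₀ θ₀ s (fun i => y i ω) + w (s + 1) ω :=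
          funext (hy s)
        rw [e]
        have a1 := ih s (by omega) (by omega)
        have a2 : Measurable (fun ω => ctl f p₀ θ₀ s (fun i => y i ω)) := by
          refine (ctl_meas f hf p₀ θ₀ s).comp (measurable_pi_iff.2 fun i => ?_)
          exact ih i (by omega) (by omega)
        exact ((hθ.mul (hf.comp a1)).add a2).add (hw s (by omega))
  refine ⟨h1, ?_⟩
  have hH : Measurable (Hst y t) := by
    rw [measurable_pi_iff]; intro i; exact h1 _ (by omega)
  refine hH.prodMk ?_
  exact ((pf_meas f hf p₀ t).comp hH).sqrt.mul (hθ.sub ((thh_meas f hf p₀ θ₀ t).comp hH))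

lemma indep_assoc {Ω E F : Type*} [MeasurableSpace Ω] [MeasurableSpace E] [MeasurableSpace F]
    (P : Measure Ω) [IsProbabilityMeasure P] (X : Ω → E) (Y : Ω → F) (Z : Ω → ℝ)
    (hX : Measurable X) (hY : Measurable Y) (hZ : Measurable Z)
    (h1 : IndepFun X (fun ω => (Y ω, Z ω)) P) (h2 : IndepFun Y Z P) :
    IndepFun (fun ω => (X ω, Y ω)) Z P := by
  have e1 := (indepFun_iff_map_prod_eq_prod_map_map hX.aemeasurable
    (hY.prodMk hZ).aemeasurable).1 h1
  have e2 := (indepFun_iff_map_prod_eq_prod_map_map hY.aemeasurable hZ.aemeasurable).1 h2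
  have e3 := (indepFun_iff_map_prod_eq_prod_map_map hX.aemeasurable hY.aemeasurable).1
    (h1.comp measurable_id measurable_fst)
  have := Measure.isProbabilityMeasure_map (μ := P) hX.aemeasurable
  have := Measure.isProbabilityMeasure_map (μ := P) hY.aemeasurable
  have := Measure.isProbabilityMeasure_map (μ := P) hZ.aemeasurable
  rw [e2] at e1
  have mp : MeasurePreserving (fun ω => (X ω, (Y ω, Z ω))) P
    ((P.map X).prod ((P.map Y).prod (P.map Z))) := ⟨by fun_prop, e1⟩
  have mp2 := (MeasurePreserving.symm (MeasurableEquiv.prodAssoc)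
    (measurePreserving_prodAssoc (P.map X) (P.map Y) (P.map Z))).comp mp
  rw [indepFun_iff_map_prod_eq_prod_map_map (hX.prodMk hY).aemeasurable hZ.aemeasurable, e3]
  exact mp2.map_eq

end Stab


/-- Theorem 1: under A1–A2, the system `y (t+1) = θ f (y t) + u t + w (t+1)` is globally
stabilizable if (i) `|f x| ≤ k₁ e^{k₂ |x|}` for all `x`; (ii) for some `b < 4`, `L > 0`,
`liminf_{l→∞} ℓ(S_b^L ∩ [-l,l])/l > 0`; and (iii) `S_b^L` contains a nonempty open
interval. -/
theorem stmt_0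
    {Ω : Type*} [MeasurableSpace Ω] (P : Measure Ω) [IsProbabilityMeasure P]
    (f : ℝ → ℝ) (hf : Measurable f)
    (θ : Ω → ℝ) (hθm : Measurable θ)
    (w : ℕ → Ω → ℝ) (hwm : ∀ t, Measurable (w t))
    (θ₀ : ℝ) (P₀ : NNReal) (hP₀ : 0 < P₀)
    (hw_gauss : ∀ t : ℕ, Measure.map (w (t + 1)) P = gaussianReal 0 1)
    (hw_indep : iIndepFun (fun t : ℕ => w (t + 1)) P)
    (hθ_gauss : Measure.map θ P = gaussianReal θ₀ P₀)
    (hθw : IndepFun θ (fun ω (t : ℕ) => w (t + 1) ω) P)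
    (k₁ k₂ : ℝ) (hk₁ : 0 < k₁) (hk₂ : 0 < k₂)
    (hfgrow : ∀ x : ℝ, |f x| ≤ k₁ * Real.exp (k₂ * |x|))
    (b L : ℝ) (hb : b < 4) (hL : 0 < L)
    (hliminf : 0 < Filter.liminf (fun l : ℝ =>
      (volume ({x : ℝ | |f x| < L * |x| ^ b} ∩ Set.Icc (-l) l)).toReal / l)
      Filter.atTop)
    (hint : ∃ u v : ℝ, u < v ∧ Set.Ioo u v ⊆ {x : ℝ | |f x| < L * |x| ^ b}) :
    ∃ g : (t : ℕ) → (Fin (t + 1) → ℝ) → ℝ, (∀ t, Measurable (g t)) ∧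
      ∀ y₀ : ℝ, ∀ y : ℕ → Ω → ℝ,
        (∀ ω, y 0 ω = y₀) →
        (∀ t ω, y (t + 1) ω =
          θ ω * f (y t ω) + g t (fun i => y i ω) + w (t + 1) ω) →
        ∀ᵐ ω ∂P, ∃ M : ℝ, ∀ t : ℕ, 1 ≤ t →
          (∑ i ∈ Finset.Icc 1 t, (y i ω) ^ 2) / t ≤ M := by
  set p₀ : ℝ := (P₀ : ℝ)⁻¹ with hp₀def
  have hP₀r : (0 : ℝ) < P₀ := by exact_mod_cast hP₀
  have hp₀ : 0 < p₀ := inv_pos.2 hP₀r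
  refine ⟨Stab.ctl f p₀ θ₀, Stab.ctl_meas f hf p₀ θ₀, ?_⟩
  intro y₀ y hy0 hy
  have hpos : ∀ z t, 0 < Stab.pf f p₀ z t := fun z t => lt_of_lt_of_le hp₀ (Stab.pf_ge _ _ _ _)
  have hym : ∀ t, Measurable (y t) := fun t =>
    (Stab.all_meas f hf p₀ θ₀ y₀ θ hθm w t (fun s _ => hwm _) y hy0 hy).1 t le_rfl
  set η := Stab.eta f p₀ θ₀ θ y with hη
  have hHη : ∀ t, Measurable (fun ω => (Stab.Hst y t ω, η t ω)) := fun t =>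
    (Stab.all_meas f hf p₀ θ₀ y₀ θ hθm w t (fun s _ => hwm _) y hy0 hy).2
  have hHm : ∀ t, Measurable (Stab.Hst y t) := Stab.Hst_meas y hym
  have hηm : ∀ t, Measurable (η t) := fun t => measurable_snd.comp (hHη t)
  -- independence of the future noise
  have hfut : ∀ t, IndepFun (fun ω => (Stab.Hst y t ω, η t ω)) (w (t + 1)) P := by
    intro t
    set Wp : Ω → (Finset.range t → ℝ) := fun ω i => w (i + 1) ω with hWp
    have hWpm : Measurable Wp := measurable_pi_iff.2 fun i => hwm _
    have a1 : IndepFun Wp (w (t + 1)) P := by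
      have h := hw_indep.indepFun_finset (Finset.range t) {t} (by simp) (fun i => hwm _)
      exact h.comp measurable_id (measurable_pi_apply (⟨t, by simp⟩ : ({t} : Finset ℕ)))
    have a2 : IndepFun θ (fun ω => (Wp ω, w (t + 1) ω)) P := by
      have hm : Measurable (fun v : ℕ → ℝ => ((fun i : Finset.range t => v i), v t)) := by fun_prop
      exact hθw.comp measurable_id hm
    have a3 := Stab.indep_assoc P θ Wp (w (t + 1)) hθm hWpm (hwm _) a2 a1
    set mt : MeasurableSpace Ω := MeasurableSpace.comap (fun ω => (θ ω, Wp ω)) inferInstance with hmt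
    have b1 : Measurable[mt] (fun ω => (θ ω, Wp ω)) := comap_measurable _
    have b2 : Measurable[mt] θ := measurable_fst.comp b1
    have b3 : ∀ s, s < t → Measurable[mt] (w (s + 1)) := fun s hs =>
      (measurable_pi_apply (⟨s, Finset.mem_range.2 hs⟩ : Finset.range t)).comp
        (measurable_snd.comp b1)
    have b4 := (@Stab.all_meas Ω mt f hf p₀ θ₀ y₀ θ b2 w t b3 y hy0 hy).2
    rw [IndepFun_iff_Indep] at a3 ⊢
    exact indep_of_indep_of_le_left a3 b4.comap_le
  -- coefficients of the rotation
  set cc : ℕ → (ℕ → ℝ) → ℝ := fun t z =>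
    Real.sqrt (Stab.pf f p₀ z t) / Real.sqrt (Stab.pf f p₀ z (t + 1)) with hcc
  set ss : ℕ → (ℕ → ℝ) → ℝ := fun t z => f (z t) / Real.sqrt (Stab.pf f p₀ z (t + 1)) with hss
  have hccm : ∀ t, Measurable (cc t) := fun t =>
    (Stab.pf_meas f hf p₀ t).sqrt.div (Stab.pf_meas f hf p₀ (t + 1)).sqrt
  have hssm : ∀ t, Measurable (ss t) := fun t =>
    (hf.comp (measurable_pi_apply t)).div (Stab.pf_meas f hf p₀ (t + 1)).sqrt
  have hcs : ∀ t z, cc t z ^ 2 + ss t z ^ 2 = 1 := by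
    intro t z
    simp only [hcc, hss]
    rw [div_pow, div_pow, Real.sq_sqrt (hpos _ _).le, Real.sq_sqrt (hpos _ _).le, ← add_div,
      ← Stab.pf_succ, div_self (hpos _ _).ne']
  set ξ : ℕ → Ω → ℝ := fun t ω => cc t (Stab.Hst y t ω) * w (t + 1) ω +
    ss t (Stab.Hst y t ω) * η t ω with hξ
  have hHt : ∀ t ω, Stab.Hst y t ω t = y t ω := fun t ω => by simp [Stab.Hst]
  have hthH : ∀ t ω, Stab.thh f p₀ θ₀ (Stab.Hst y t ω) t = Stab.thh f p₀ θ₀ (fun i => y i ω) t :=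
    fun t ω => Stab.thh_congr _ _ _ _ _ _ fun i hi => by simp [Stab.Hst, hi]
  have hyε : ∀ t ω, y (t + 1) ω =
      (θ ω - Stab.thh f p₀ θ₀ (fun i => y i ω) t) * f (y t ω) + w (t + 1) ω := by
    intro t ω
    rw [hy t ω, Stab.ctl_eq f p₀ θ₀ t (fun i => y i ω)]; ring
  have hyξ : ∀ t ω, y (t + 1) ω = Real.sqrt (Stab.pf f p₀ (fun i => y i ω) (t + 1) /
      Stab.pf f p₀ (fun i => y i ω) t) * ξ t ω := by
    intro t ω
    simp only [hξ, hcc, hss, hη, Stab.eta]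
    rw [hHt, hthH, Stab.pf_Hst f p₀ y _ _ (by omega), Stab.pf_Hst f p₀ y _ _ (by omega), hyε t ω,
      Real.sqrt_div (hpos _ _).le]
    have h1 := Real.sqrt_pos.2 (hpos (fun i => y i ω) t)
    have h2 := Real.sqrt_pos.2 (hpos (fun i => y i ω) (t + 1))
    field_simp
    ring
  have hηrec : ∀ t ω, η (t + 1) ω = -ss t (Stab.Hst y t ω) * w (t + 1) ω +
      cc t (Stab.Hst y t ω) * η t ω := by
    intro t ω
    simp only [hcc, hss, hη, Stab.eta]
    rw [hHt, hthH, hthH, Stab.pf_Hst f p₀ y _ _ (by omega), Stab.pf_Hst f p₀ y _ _ (by omega),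
      Stab.pf_Hst f p₀ y _ _ (by omega)]
    have e : Stab.thh f p₀ θ₀ (fun i => y i ω) (t + 1) = Stab.thh f p₀ θ₀ (fun i => y i ω) t +
        f (y t ω) * y (t + 1) ω / Stab.pf f p₀ (fun i => y i ω) (t + 1) := by
      unfold Stab.thh; rw [Finset.sum_range_succ]; ring
    rw [e, hyε t ω]
    have h1 := Real.sqrt_pos.2 (hpos (fun i => y i ω) t)
    have h2 := Real.sqrt_pos.2 (hpos (fun i => y i ω) (t + 1))
    have q1 := Real.sq_sqrt (hpos (fun i => y i ω) t).le
    have q2 := Real.sq_sqrt (hpos (fun i => y i ω) (t + 1)).le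
    have q3 := Stab.pf_succ f p₀ (fun i => y i ω) t
    set A := Real.sqrt (Stab.pf f p₀ (fun i => y i ω) t)
    set B := Real.sqrt (Stab.pf f p₀ (fun i => y i ω) (t + 1))
    set ε := θ ω - Stab.thh f p₀ θ₀ (fun i => y i ω) t with hε
    have q4 : B ^ 2 = A ^ 2 + f (y t ω) ^ 2 := by rw [q1, q2, q3]
    rw [← q2, ← sub_sub, ← hε]
    field_simp
    linear_combination ε * q4
  have hinv : ∀ t, P.map (η t) = gaussianReal 0 1 ∧ IndepFun (Stab.Hst y t) (η t) P := by
    intro t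
    induction t with
    | zero =>
      constructor
      · have e : η 0 = (fun x => Real.sqrt p₀ * x) ∘ (fun x => x - θ₀) ∘ θ := by
          funext ω
          simp [hη, Stab.eta, Stab.pf, Stab.thh]
        rw [e, ← Measure.map_map (by fun_prop) (by fun_prop),
          ← Measure.map_map (by fun_prop) hθm, hθ_gauss, gaussianReal_map_sub_const,
          gaussianReal_map_const_mul]
        congr 1
        · simp
        · ext
          simp [Real.sq_sqrt hp₀.le, hp₀def, hP₀r.ne']
      · have e : Stab.Hst y 0 = fun _ => fun _ => y₀ := by
          funext ω i
          simp [Stab.Hst, hy0]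
        rw [e]
        exact indepFun_const_left _ _
    | succ t ih =>
      obtain ⟨_, i2, _, i4⟩ := Stab.innov_step P (Stab.Hst y t) (hHm t) (η t) (w (t + 1)) (hηm t)
        (hwm _) (cc t) (ss t) (hccm t) (hssm t) (hcs t) ih.1 (hw_gauss t) ih.2 (hfut t)
      have e : η (t + 1) = fun ω => -ss t (Stab.Hst y t ω) * w (t + 1) ω +
        cc t (Stab.Hst y t ω) * η t ω := funext (hηrec t)
      refine ⟨by rw [e]; exact i2, ?_⟩
      set Ψ : (ℕ → ℝ) × ℝ → (ℕ → ℝ) := fun q i => if i ≤ t then q.1 i else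
        Real.sqrt (Stab.pf f p₀ q.1 (t + 1) / Stab.pf f p₀ q.1 t) * q.2 with hΨ
      have hΨm : Measurable Ψ := by
        rw [measurable_pi_iff]
        intro i
        simp only [hΨ]
        split_ifs
        · fun_prop
        · have h1 : Measurable (fun q : (ℕ → ℝ) × ℝ => Stab.pf f p₀ q.1 t) :=
            (Stab.pf_meas f hf p₀ t).comp measurable_fst
          have h2 : Measurable (fun q : (ℕ → ℝ) × ℝ => Stab.pf f p₀ q.1 (t + 1)) :=
            (Stab.pf_meas f hf p₀ (t + 1)).comp measurable_fst
          exact (h2.div h1).sqrt.mul measurable_snd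
      have e2 : Stab.Hst y (t + 1) = Ψ ∘ (fun ω => (Stab.Hst y t ω, ξ t ω)) := by
        funext ω i
        simp only [hΨ, Function.comp]
        rw [Stab.pf_Hst f p₀ y _ _ (by omega), Stab.pf_Hst f p₀ y _ _ (by omega), ← hyξ t ω]
        split_ifs with h
        · simp only [Stab.Hst]; rw [min_eq_left h, min_eq_left (by omega)]
        · simp only [Stab.Hst]; rw [min_eq_right (by omega)]
      rw [e, e2]
      exact i4.comp hΨm measurable_id
  have hstep := fun t => Stab.innov_step P (Stab.Hst y t) (hHm t) (η t) (w (t + 1)) (hηm t)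
        (hwm _) (cc t) (ss t) (hccm t) (hssm t) (hcs t) (hinv t).1 (hw_gauss t) (hinv t).2 (hfut t)
  have hξm : ∀ t, Measurable (ξ t) := fun t =>
    (((hccm t).comp (hHm t)).mul (hwm _)).add (((hssm t).comp (hHm t)).mul (hηm t))
  exact Stab.core P f hf p₀ hp₀ y hym ξ hξm (fun t => (hstep t).1) (fun t => (hstep t).2.2.1) hyξ
    k₁ k₂ hk₁ hk₂ hfgrow b L hb hL hliminf
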